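/- arXiv:1512.01638 — 2 statements merged into one kernel-verified Lean document; each statement's English description precedes it below -/
import Mathlib

section
/- Let γ ∈ [−3,−2), let p satisfy 3/(3+γ+1) < p ≤ ∞, and let θ' > 3(1−1/p). Then there exists a constant C > 0 such that for every measurable f : ℝ³ → ℝ with ‖⟨·⟩^{θ'} f‖_{L^p(ℝ³)} < ∞ and every v ∈ ℝ³ and each j ∈ {1,2,3}, the integral (b_j*f)(v) = ∫_{ℝ³} b_j(v−v_*) f(v_*) dv_* converges absolutely and |(b_j*f)(v)| ≤ C ⟨v⟩^{γ+1} ‖⟨·⟩^{θ'} f‖_{L^p}. -/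
noncomputable section

open MeasureTheory Real Filter

abbrev V3 := EuclideanSpace ℝ (Fin 3)

/-- Japanese bracket ⟨v⟩ = (1+|v|²)^{1/2}. -/
def jap (v : V3) : ℝ := Real.sqrt (1 + ‖v‖ ^ 2)

/-- Standard Gaussian μ on ℝ³. -/
def gaussM (v : V3) : ℝ := (2 * Real.pi) ^ (-(3 : ℝ) / 2) * Real.exp (-‖v‖ ^ 2 / 2)

/-- Landau kernel matrix a_{ij}(z). -/
def aker (γ : ℝ) (z : V3) (i j : Fin 3) : ℝ :=
  ‖z‖ ^ (γ + 2) * ((if i = j then (1 : ℝ) else 0) - z i * z j / ‖z‖ ^ 2)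

/-- ā_{ij} = a_{ij} * μ. -/
def abar (γ : ℝ) (v : V3) (i j : Fin 3) : ℝ := ∫ w : V3, aker γ (v - w) i j * gaussM w

def bker (γ : ℝ) (z : V3) (i : Fin 3) : ℝ := -2 * ‖z‖ ^ γ * z i

/-- b̄_i = b_i * μ. -/
def bbar (γ : ℝ) (v : V3) (i : Fin 3) : ℝ := ∫ w : V3, bker γ (v - w) i * gaussM w

/-- J_β(v) = ∫ |v−w|^β μ(w) dw. -/
def Jfun (β : ℝ) (v : V3) : ℝ := ∫ w : V3, ‖v - w‖ ^ β * gaussM w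

/-- c̄(v) = −2(γ+3) J_γ(v). -/
def cbar (γ : ℝ) (v : V3) : ℝ := -2 * (γ + 3) * Jfun γ v

/-- ℓ₁(v). -/
def ell1 (γ : ℝ) (v : V3) : ℝ :=
  ∫ w : V3, (1 - ((∑ i, v i * w i) / (‖v‖ * ‖w‖)) ^ 2) * ‖w‖ ^ (γ + 2) * gaussM (v - w)

/-- Squared Euclidean norm of the cross product of two vectors in ℝ³. -/
def crossSq (a b : V3) : ℝ :=
  ∑ i, (crossProduct (R := ℝ) (fun k => a k) (fun k => b k) i) ^ 2

/-- ℓ₂(v). -/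
def ell2 (γ : ℝ) (v : V3) : ℝ :=
  ∫ w : V3,
    (1 - (1 / 2) * crossSq (‖v‖⁻¹ • v) (‖w‖⁻¹ • w)) * ‖w‖ ^ (γ + 2) * gaussM (v - w)

/-- Projection P_v ξ on the direction v. -/
def Pv (v ξ : V3) : V3 := ((∑ i, ξ i * v i) / ‖v‖ ^ 2) • v

/-- Partial derivative in the i-th coordinate direction. -/
def pd (i : Fin 3) (f : V3 → ℝ) : V3 → ℝ := fun v => fderiv ℝ f v (EuclideanSpace.single i 1)

/-- Anisotropic gradient ∇̃f = P_v ∇f + ⟨v⟩ (I − P_v) ∇f. -/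
def anisoGrad (f : V3 → ℝ) (v : V3) : V3 :=
  Pv v (gradient f v) + jap v • (gradient f v - Pv v (gradient f v))

/-- The filter |v| → ∞ on ℝ³. -/
def normAtTop : Filter V3 := Filter.comap (fun v : V3 => ‖v‖) Filter.atTop

/-- Convolution on ℝ³. -/
def conv3 (f g : V3 → ℝ) (v : V3) : ℝ := ∫ w : V3, f (v - w) * g w

lemma jap_pos (v : V3) : 0 < jap v := Real.sqrt_pos.mpr (by positivity)

lemma one_le_jap (v : V3) : 1 ≤ jap v := Real.one_le_sqrt.mpr (by nlinarith [norm_nonneg v])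

lemma measurable_jap : Measurable jap := by
  unfold jap
  fun_prop

lemma jap_le_jap_add_norm_sub (v w : V3) : jap v ≤ jap w + ‖v - w‖ := by
  have hv : ‖v‖ ≤ ‖w‖ + ‖v - w‖ := by
    simpa using norm_add_le w (v - w)
  have hw : ‖w‖ ≤ jap w := Real.le_sqrt_of_sq_le (by linarith)
  have hsq : jap w ^ 2 = 1 + ‖w‖ ^ 2 := Real.sq_sqrt (by positivity)
  refine Real.sqrt_le_iff.mpr ⟨by linarith [jap_pos w, norm_nonneg (v - w)], ?_⟩
  nlinarith [norm_nonneg v, norm_nonneg w, norm_nonneg (v - w),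
    mul_le_mul_of_nonneg_right hw (norm_nonneg (v - w))]

lemma integrable_jap_rpow_neg {b : ℝ} (hb : 3 < b) : Integrable (fun w : V3 => jap w ^ (-b)) := by
  have h := integrable_rpow_neg_one_add_norm_sq (E := V3) (μ := volume) (r := b) (by simpa using hb)
  refine h.congr (.of_forall fun w => ?_)
  simp only [jap, Real.sqrt_eq_rpow]
  rw [← Real.rpow_mul (by positivity)]
  congr 1
  ring

lemma eqOn_pow_mul_indicator_rpow (a R : ℝ) :
    Set.EqOn
      (fun y : ℝ => y ^ (Module.finrank ℝ V3 - 1) •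
        (Set.Iio R).indicator (fun t : ℝ => t ^ (-a)) y)
      ((Set.Iio R).indicator fun t : ℝ => t ^ (2 - a)) (Set.Ioi 0) := by
  intro y hy
  by_cases h : y < R
  · simp only [finrank_euclideanSpace, Fintype.card_fin, Set.mem_Iio, h, Set.indicator_of_mem,
      smul_eq_mul]
    rw [sub_eq_add_neg, Real.rpow_add (Set.mem_Ioi.mp hy)]
    norm_num
  · simp [h]

lemma integrable_indicator_norm_rpow_neg {a : ℝ} (ha : a < 3) (R : ℝ) :
    Integrable (fun z : V3 => (Set.Iio R).indicator (fun t : ℝ => t ^ (-a)) ‖z‖) := by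
  rw [integrable_fun_norm_addHaar volume (f := (Set.Iio R).indicator (fun t : ℝ => t ^ (-a))),
    integrableOn_congr_fun (eqOn_pow_mul_indicator_rpow a R) measurableSet_Ioi,
    IntegrableOn, integrable_indicator_iff measurableSet_Iio, IntegrableOn,
    Measure.restrict_restrict measurableSet_Iio, Set.Iio_inter_Ioi]
  rcases le_or_gt R 0 with hR | hR
  · simp [Set.Ioo_eq_empty_of_le hR]
  · exact (intervalIntegral.integrableOn_Ioo_rpow_iff hR).mpr (by linarith)

lemma integral_indicator_norm_rpow_neg {a : ℝ} (ha : a < 3) {R : ℝ} (hR : 0 ≤ R) :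
    ∫ z : V3, (Set.Iio R).indicator (fun t : ℝ => t ^ (-a)) ‖z‖
      = 3 * volume.real (Metric.ball (0 : V3) 1) / (3 - a) * R ^ (3 - a) := by
  rw [integral_fun_norm_addHaar volume ((Set.Iio R).indicator (fun t : ℝ => t ^ (-a))),
    setIntegral_congr_fun measurableSet_Ioi (eqOn_pow_mul_indicator_rpow a R),
    integral_indicator measurableSet_Iio, Measure.restrict_restrict measurableSet_Iio,
    Set.Iio_inter_Ioi, ← integral_Ioc_eq_integral_Ioo, ← intervalIntegral.integral_of_le hR,
    integral_rpow (.inl (by linarith)), show 2 - a + 1 = 3 - a by ring,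
    Real.zero_rpow (by linarith)]
  simp only [finrank_euclideanSpace, Fintype.card_fin, nsmul_eq_mul, smul_eq_mul, Nat.cast_ofNat]
  ring

lemma norm_sub_rpow_mul_jap_rpow_le {a b : ℝ} (ha : 0 < a) (hb : 0 < b) (v w : V3) :
    ‖v - w‖ ^ (-a) * jap w ^ (-b) ≤ (jap v / 4) ^ (-a) * jap w ^ (-b)
      + (3 / 4 * jap v) ^ (-b) *
        (Set.Iio (jap v / 4)).indicator (fun t : ℝ => t ^ (-a)) ‖v - w‖ := by
  have hv := jap_pos v
  have hw := jap_pos w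
  by_cases h : ‖v - w‖ < jap v / 4
  · simp only [Set.mem_Iio, h, Set.indicator_of_mem]
    have h1 : jap w ^ (-b) ≤ (3 / 4 * jap v) ^ (-b) :=
      Real.rpow_le_rpow_of_nonpos (by positivity)
        (by linarith [jap_le_jap_add_norm_sub v w]) (by linarith)
    have h2 := mul_le_mul_of_nonneg_left h1 (Real.rpow_nonneg (norm_nonneg (v - w)) (-a))
    have h3 : 0 ≤ (jap v / 4) ^ (-a) * jap w ^ (-b) := by positivity
    linarith
  · simp only [Set.mem_Iio, h, not_false_eq_true, Set.indicator_of_notMem, mul_zero, add_zero]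
    exact mul_le_mul_of_nonneg_right
      (Real.rpow_le_rpow_of_nonpos (by positivity) (not_lt.mp h) (by linarith)) (by positivity)

/-- Convolving the Riesz-type kernel `‖·‖ ^ (-a)` with `⟨·⟩ ^ (-b)` preserves the decay rate `a`
when `0 < a < 3 < b`. -/
lemma exists_integral_norm_sub_rpow_mul_jap_rpow_le {a b : ℝ} (ha : 0 < a) (ha3 : a < 3)
    (hb : 3 < b) :
    ∃ K > (0 : ℝ), ∀ v : V3,
      Integrable (fun w : V3 => ‖v - w‖ ^ (-a) * jap w ^ (-b)) ∧
      ∫ w : V3, ‖v - w‖ ^ (-a) * jap w ^ (-b) ≤ K * jap v ^ (-a) := by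
  set A : ℝ := ∫ w : V3, jap w ^ (-b)
  set B : ℝ := 3 * volume.real (Metric.ball (0 : V3) 1) / (3 - a)
  have hA : 0 ≤ A := integral_nonneg fun w => Real.rpow_nonneg (jap_pos w).le _
  have hB : 0 ≤ B := div_nonneg (by positivity) (by linarith)
  refine ⟨(1 / 4) ^ (-a) * A + (3 / 4) ^ (-b) * (B * (1 / 4) ^ (3 - a)) + 1, by positivity,
    fun v => ?_⟩
  have hv := jap_pos v
  have h1 := (integrable_jap_rpow_neg hb).const_mul ((jap v / 4) ^ (-a))
  have h2 := ((integrable_indicator_norm_rpow_neg ha3 (jap v / 4)).comp_sub_left v).const_mul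
    ((3 / 4 * jap v) ^ (-b))
  have hle := norm_sub_rpow_mul_jap_rpow_le ha (b := b) (by linarith) v
  have hint : Integrable (fun w : V3 => ‖v - w‖ ^ (-a) * jap w ^ (-b)) := by
    refine (h1.add h2).mono' ?_ (.of_forall fun w => ?_)
    · have := measurable_jap
      exact Measurable.aestronglyMeasurable (by fun_prop)
    · rw [Real.norm_of_nonneg (mul_nonneg (Real.rpow_nonneg (norm_nonneg _) _)
        (Real.rpow_nonneg (jap_pos w).le _))]
      exact hle w
  refine ⟨hint, (integral_mono hint (h1.add h2) hle).trans ?_⟩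
  simp only [Pi.add_apply]
  rw [integral_add h1 h2, integral_const_mul, integral_const_mul,
    integral_sub_left_eq_self
      (fun z : V3 => (Set.Iio (jap v / 4)).indicator (fun t : ℝ => t ^ (-a)) ‖z‖) volume v,
    integral_indicator_norm_rpow_neg ha3 (by positivity), div_eq_mul_one_div (jap v) 4,
    Real.mul_rpow hv.le (by norm_num), Real.mul_rpow hv.le (by norm_num),
    Real.mul_rpow (by norm_num) hv.le]
  have hdecay : jap v ^ (-b) * jap v ^ (3 - a) ≤ jap v ^ (-a) := by
    rw [← Real.rpow_add hv]
    exact Real.rpow_le_rpow_of_exponent_le (one_le_jap v) (by linarith)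
  have hmul := mul_le_mul_of_nonneg_left hdecay
    (show 0 ≤ (3 / 4 : ℝ) ^ (-b) * (B * (1 / 4) ^ (3 - a)) by positivity)
  have hpos : 0 ≤ jap v ^ (-a) := by positivity
  linarith

lemma abs_bker_le (γ : ℝ) (z : V3) (j : Fin 3) : |bker γ z j| ≤ 2 * ‖z‖ ^ (γ + 1) := by
  rcases eq_or_ne z 0 with rfl | hz
  · have : (0 : ℝ) ≤ 0 ^ (γ + 1) := Real.rpow_nonneg le_rfl _
    simpa [bker] using this
  · have hz' : 0 < ‖z‖ := norm_pos_iff.mpr hz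
    have hj : |z j| ≤ ‖z‖ := by simpa using PiLp.norm_apply_le z j
    rw [bker, abs_mul, abs_mul, abs_of_nonneg (Real.rpow_nonneg hz'.le γ), Real.rpow_add hz',
      Real.rpow_one]
    have := mul_le_mul_of_nonneg_left hj (Real.rpow_nonneg hz'.le γ)
    norm_num
    linarith

lemma measurable_bker_sub (γ : ℝ) (v : V3) (j : Fin 3) :
    Measurable fun w : V3 => bker γ (v - w) j := by
  unfold bker
  fun_prop

/-- The kernel `b_j(v - ·)⟨·⟩ ^ (-θ)` has `L^q` norm of order `⟨v⟩ ^ (γ + 1)`. -/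
lemma exists_eLpNorm_bker_mul_jap_rpow_le {γ θ : ℝ} (hγ : γ < -1) {q : ENNReal} (hq0 : q ≠ 0)
    (hq : q ≠ ⊤) (hγq : -(γ + 1) * q.toReal < 3) (hθq : 3 < θ * q.toReal) :
    ∃ C > (0 : ℝ), ∀ (v : V3) (j : Fin 3),
      eLpNorm (fun w : V3 => bker γ (v - w) j * jap w ^ (-θ)) q volume
        ≤ ENNReal.ofReal (C * jap v ^ (γ + 1)) := by
  have hr : 0 < q.toReal := ENNReal.toReal_pos hq0 hq
  set r := q.toReal with hr_def
  obtain ⟨K, hK, hKv⟩ := exists_integral_norm_sub_rpow_mul_jap_rpow_le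
    (mul_pos (by linarith : 0 < -(γ + 1)) hr) hγq hθq
  refine ⟨2 * K ^ r⁻¹, by positivity, fun v j => ?_⟩
  obtain ⟨hint, hle⟩ := hKv v
  have hv := jap_pos v
  set g : V3 → ℝ := fun w => ‖v - w‖ ^ (γ + 1) * jap w ^ (-θ) with hg
  have hg0 : ∀ w, 0 ≤ g w := fun w =>
    mul_nonneg (Real.rpow_nonneg (norm_nonneg _) _) (Real.rpow_nonneg (jap_pos w).le _)
  have hgr : ∀ w, ‖g w‖ ^ r = ‖v - w‖ ^ (-(-(γ + 1) * r)) * jap w ^ (-(θ * r)) := fun w => by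
    rw [Real.norm_of_nonneg (hg0 w), hg]
    simp only
    rw [Real.mul_rpow (Real.rpow_nonneg (norm_nonneg _) _) (Real.rpow_nonneg (jap_pos w).le _),
      ← Real.rpow_mul (norm_nonneg _), ← Real.rpow_mul (jap_pos w).le]
    ring_nf
  have hgm : AEStronglyMeasurable g volume := by
    have := measurable_jap
    exact Measurable.aestronglyMeasurable (by fun_prop)
  have hgL : MemLp g q volume := by
    rw [← integrable_norm_rpow_iff hgm hq0 hq]
    simpa only [← hr_def, hgr] using hint
  have hmono : eLpNorm (fun w : V3 => bker γ (v - w) j * jap w ^ (-θ)) q volume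
      ≤ ENNReal.ofReal 2 * eLpNorm g q volume := by
    refine eLpNorm_le_mul_eLpNorm_of_ae_le_mul (.of_forall fun w => ?_) q
    rw [Real.norm_of_nonneg (hg0 w), norm_mul, Real.norm_eq_abs,
      Real.norm_of_nonneg (Real.rpow_nonneg (jap_pos w).le _), hg, ← mul_assoc]
    exact mul_le_mul_of_nonneg_right (abs_bker_le γ _ j) (Real.rpow_nonneg (jap_pos w).le _)
  refine hmono.trans ?_
  rw [hgL.eLpNorm_eq_integral_rpow_norm hq0 hq, ← ENNReal.ofReal_mul (by norm_num), ← hr_def]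
  simp only [hgr]
  refine ENNReal.ofReal_le_ofReal ?_
  rw [mul_assoc]
  refine mul_le_mul_of_nonneg_left ?_ (by norm_num)
  refine (Real.rpow_le_rpow (integral_nonneg fun w => mul_nonneg
    (Real.rpow_nonneg (norm_nonneg _) _) (Real.rpow_nonneg (jap_pos w).le _)) hle
    (by positivity)).trans_eq ?_
  rw [Real.mul_rpow hK.le (by positivity), ← Real.rpow_mul hv.le]
  congr 2
  field_simp

/-- Lemma 4.2 (ii): weighted L^p bounds on b_j * f. -/
theorem stmt16 (γ : ℝ) (hγ : γ ∈ Set.Ico (-3 : ℝ) (-2)) (p : ENNReal)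
    (hp : ENNReal.ofReal (3 / (3 + γ + 1)) < p) (θ' : ℝ)
    (hθ' : 3 * (1 - p⁻¹.toReal) < θ') :
    ∃ C > (0 : ℝ), ∀ f : V3 → ℝ, Measurable f →
      eLpNorm (fun v => jap v ^ θ' * f v) p volume < ⊤ →
      ∀ (v : V3) (j : Fin 3),
        Integrable (fun w : V3 => bker γ (v - w) j * f w) ∧
        |conv3 (fun z => bker γ z j) f v|
          ≤ C * jap v ^ (γ + 1) * (eLpNorm (fun v => jap v ^ θ' * f v) p volume).toReal := by
  obtain ⟨hγ3, hγ2⟩ := hγ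
  have hpinv : p⁻¹.toReal < (γ + 4) / 3 := by
    refine ENNReal.toReal_lt_of_lt_ofReal ?_
    have h := ENNReal.inv_lt_inv.mpr hp
    rwa [← ENNReal.ofReal_inv_of_pos (div_pos (by norm_num) (by linarith)), inv_div,
      show 3 + γ + 1 = γ + 4 by ring] at h
  have hp1 : p⁻¹ < 1 := by
    refine ENNReal.inv_lt_one.mpr (lt_of_le_of_lt ?_ hp)
    rw [ENNReal.one_le_ofReal, le_div_iff₀ (by linarith)]
    linarith
  set q : ENNReal := (1 - p⁻¹)⁻¹ with hq_def
  have hq0 : q ≠ 0 := ENNReal.inv_ne_zero.mpr (ENNReal.sub_ne_top ENNReal.one_ne_top)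
  have hq : q ≠ ⊤ := ENNReal.inv_ne_top.mpr (tsub_pos_of_lt hp1).ne'
  have hqr : q.toReal = (1 - p⁻¹.toReal)⁻¹ := by
    rw [hq_def, ENNReal.toReal_inv, ENNReal.toReal_sub_of_le hp1.le ENNReal.one_ne_top,
      ENNReal.toReal_one]
  have hpos : 0 < 1 - p⁻¹.toReal := by linarith
  have : ENNReal.HolderTriple q p 1 := ⟨by
    rw [hq_def, inv_inv, tsub_add_cancel_of_le hp1.le, inv_one]⟩
  obtain ⟨C, hC, hbound⟩ := exists_eLpNorm_bker_mul_jap_rpow_le (γ := γ) (θ := θ') (by linarith)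
    hq0 hq (by rw [hqr, ← div_eq_mul_inv, div_lt_iff₀ hpos]; linarith)
    (by rw [hqr, ← div_eq_mul_inv, lt_div_iff₀ hpos]; linarith)
  refine ⟨C, hC, fun f hf hfp v j => ?_⟩
  have hjap := measurable_jap
  have hF : AEStronglyMeasurable (fun w : V3 => jap w ^ θ' * f w) volume :=
    Measurable.aestronglyMeasurable (by fun_prop)
  have hG : AEStronglyMeasurable (fun w : V3 => bker γ (v - w) j * jap w ^ (-θ')) volume :=
    ((measurable_bker_sub γ v j).mul (hjap.pow_const _)).aestronglyMeasurable
  have hmul : (fun w : V3 => bker γ (v - w) j * f w)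
      = (fun w : V3 => bker γ (v - w) j * jap w ^ (-θ')) • fun w : V3 => jap w ^ θ' * f w := by
    funext w
    have hw := jap_pos w
    have hne : jap w ^ θ' ≠ 0 := (Real.rpow_pos_of_pos hw _).ne'
    simp only [Pi.smul_apply', smul_eq_mul]
    rw [Real.rpow_neg hw.le]
    field_simp
  have hle : eLpNorm (fun w : V3 => bker γ (v - w) j * f w) 1 volume
      ≤ ENNReal.ofReal (C * jap v ^ (γ + 1))
        * eLpNorm (fun w => jap w ^ θ' * f w) p volume := by
    rw [hmul]
    exact (eLpNorm_smul_le_mul_eLpNorm (p := q) (q := p) hF hG).trans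
      (mul_le_mul_left (hbound v j) _)
  have htop : ENNReal.ofReal (C * jap v ^ (γ + 1))
      * eLpNorm (fun w => jap w ^ θ' * f w) p volume < ⊤ :=
    ENNReal.mul_lt_top ENNReal.ofReal_lt_top hfp
  have hint : Integrable (fun w : V3 => bker γ (v - w) j * f w) :=
    memLp_one_iff_integrable.mp
      ⟨((measurable_bker_sub γ v j).mul hf).aestronglyMeasurable, hle.trans_lt htop⟩
  refine ⟨hint, ?_⟩
  have hreal := ENNReal.toReal_mono htop.ne hle
  rw [ENNReal.toReal_mul, ENNReal.toReal_ofReal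
    (mul_nonneg hC.le (Real.rpow_nonneg (jap_pos v).le _)), eLpNorm_one_eq_lintegral_enorm,
    ← integral_norm_eq_lintegral_enorm hint.aestronglyMeasurable] at hreal
  exact (norm_integral_le_integral_norm _).trans hreal
end
end

section
/- Let λ > 0, γ < 0, let s ∈ (0, |γ|) and let 0 < κ₀ < κ₁. Then there exist constants C > 0 and λ' > 0 such that for all t ≥ 0 one has inf_{R > 0} ( exp(−λ ⟨R⟩^{γ+s} t) + exp(−2(κ₁−κ₀) ⟨R⟩^s) ) ≤ C exp(−λ' t^{s/|γ|}), where ⟨x⟩ = (1+x²)^{1/2}. -/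
noncomputable section

open Real

/-- Japanese bracket of a real number. -/
def japR (x : ℝ) : ℝ := Real.sqrt (1 + x ^ 2)

lemma one_le_japR (x : ℝ) : 1 ≤ japR x :=
  Real.one_le_sqrt.mpr (by nlinarith [sq_nonneg x])

/-- Every number larger than `1` is the Japanese bracket of a positive number. -/
lemma exists_pos_japR_eq {y : ℝ} (hy : 1 < y) : ∃ R : ℝ, 0 < R ∧ japR R = y := by
  have h : 0 < y ^ 2 - 1 := by nlinarith
  refine ⟨√(y ^ 2 - 1), Real.sqrt_pos.mpr h, ?_⟩
  rw [japR, Real.sq_sqrt h.le, add_sub_cancel, Real.sqrt_sq (by linarith)]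

/-- The quantitative decay estimate behind the stretched-exponential-weight case of the
semigroup decay: for λ > 0, γ < 0, 0 < s < |γ|, 0 < κ₀ < κ₁,
inf_{R>0} ( exp(−λ⟨R⟩^{γ+s} t) + exp(−2(κ₁−κ₀)⟨R⟩^s) ) ≤ C exp(−λ' t^{s/|γ|}) for t ≥ 0. -/
theorem stmt19 (lam γ s κ₀ κ₁ : ℝ) (hlam : 0 < lam) (hγ : γ < 0)
    (hs : s ∈ Set.Ioo 0 |γ|) (hκ₀ : 0 < κ₀) (hκ : κ₀ < κ₁) :
    ∃ C > (0 : ℝ), ∃ lam' > (0 : ℝ), ∀ t : ℝ, 0 ≤ t →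
      (⨅ R : {R : ℝ // 0 < R},
          (Real.exp (-lam * japR (R : ℝ) ^ (γ + s) * t)
            + Real.exp (-2 * (κ₁ - κ₀) * japR (R : ℝ) ^ s)))
        ≤ C * Real.exp (-lam' * t ^ (s / |γ|)) := by
  obtain ⟨hs0, -⟩ := hs
  have hg : 0 < |γ| := abs_pos.mpr hγ.ne
  have hδ : 0 < 2 * (κ₁ - κ₀) := by linarith
  set c := min lam (2 * (κ₁ - κ₀))
  have hc0 : 0 < c := lt_min hlam hδ
  have hbdd (t : ℝ) : BddBelow (Set.range fun R : {R : ℝ // 0 < R} ↦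
      Real.exp (-lam * japR (R : ℝ) ^ (γ + s) * t)
        + Real.exp (-2 * (κ₁ - κ₀) * japR (R : ℝ) ^ s)) :=
    ⟨0, by rintro _ ⟨R, rfl⟩; positivity⟩
  refine ⟨2 * Real.exp c, by positivity, c, hc0, fun t ht ↦ ?_⟩
  rcases le_or_gt t 1 with ht1 | ht1
  · refine (ciInf_le (hbdd t) ⟨1, one_pos⟩).trans ?_
    have hj : 0 < japR 1 := one_pos.trans_le (one_le_japR 1)
    have h1 : Real.exp (-lam * japR 1 ^ (γ + s) * t) ≤ 1 := by
      rw [Real.exp_le_one_iff, neg_mul, neg_mul, neg_nonpos]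
      positivity
    have h2 : Real.exp (-2 * (κ₁ - κ₀) * japR 1 ^ s) ≤ 1 := by
      rw [Real.exp_le_one_iff, neg_mul, neg_mul, neg_nonpos]
      exact mul_nonneg hδ.le (by positivity)
    have h3 : t ^ (s / |γ|) ≤ 1 := Real.rpow_le_one ht ht1 (by positivity)
    have h4 : 1 ≤ Real.exp c * Real.exp (-c * t ^ (s / |γ|)) := by
      rw [← Real.exp_add, Real.one_le_exp_iff]
      nlinarith
    dsimp only
    linarith
  · have ht0 : 0 < t := one_pos.trans ht1
    obtain ⟨R, hR, hRt⟩ := exists_pos_japR_eq (Real.one_lt_rpow ht1 (one_div_pos.mpr hg))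
    refine (ciInf_le (hbdd t) ⟨R, hR⟩).trans ?_
    have hpow : japR R ^ (γ + s) * t = t ^ (s / |γ|) := by
      rw [hRt, ← Real.rpow_mul ht, ← Real.rpow_add_one ht0.ne', abs_of_neg hγ]
      congr 1
      field_simp [hγ.ne]
      ring
    have hpow' : japR R ^ s = t ^ (s / |γ|) := by
      rw [hRt, ← Real.rpow_mul ht, one_div_mul_eq_div]
    have hT : 0 ≤ t ^ (s / |γ|) := by positivity
    have h1 : Real.exp (-lam * t ^ (s / |γ|)) ≤ Real.exp (-c * t ^ (s / |γ|)) := by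
      gcongr
      exact min_le_left _ _
    have h2 : Real.exp (-2 * (κ₁ - κ₀) * t ^ (s / |γ|)) ≤ Real.exp (-c * t ^ (s / |γ|)) := by
      rw [neg_mul 2]
      gcongr
      exact min_le_right _ _
    have h3 : 1 ≤ Real.exp c := Real.one_le_exp hc0.le
    dsimp only
    rw [mul_assoc (-lam), hpow, hpow']
    nlinarith [Real.exp_pos (-c * t ^ (s / |γ|))]
end
end
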